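/- Let d = mJ with m > 1, let W ⊂ ℤ_m with |W| = L < m, and let Ω = ∪_{r∈W} (mℤ_d + r) ⊂ ℤ_d. Then Y = {e_i, A e_i, …, A^{m−1} e_i : i ∈ Ω} is a frame for ℓ²(ℤ_d) for every A ∈ ℬ_L if and only if the |W|×m submatrix (F_m)_W of the normalized discrete Fourier matrix F_m formed by the rows indexed by W is full spark. -/

import Mathlib

open Matrix

/-- Unnormalized discrete Fourier transform of `a : ZMod d → ℂ`. -/
noncomputable def hatKer (d : ℕ) [NeZero d] (a : ZMod d → ℂ) : ZMod d → ℂ :=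
  fun j => ∑ k : ZMod d,
    a k * Complex.exp (-(2 * (Real.pi : ℂ) * Complex.I) * ((j.val : ℂ) * (k.val : ℂ)) / (d : ℂ))

/-- The circular convolution operator with kernel `a`, as a matrix. -/
def convMat (d : ℕ) (a : ZMod d → ℂ) : Matrix (ZMod d) (ZMod d) ℂ :=
  Matrix.of fun k i => a (k - i)

/-- The normalized discrete Fourier matrix `F_d`. -/
noncomputable def FdMat (d : ℕ) : Matrix (ZMod d) (ZMod d) ℂ :=
  Matrix.of fun j k =>
    ((Real.sqrt d : ℝ) : ℂ)⁻¹ *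
      Complex.exp (-(2 * (Real.pi : ℂ) * Complex.I) * ((j.val : ℂ) * (k.val : ℂ)) / (d : ℂ))

/-- With `d = mJ` and `a_k = (â(k), â(k+J), …, â(k+(m-1)J))`, this is
`max_{k<J} M_{D_k}`, the largest number of equal entries among the `a_k`'s. -/
noncomputable def maxMultB (d m J : ℕ) [NeZero d] (b : ZMod d → ℂ) : ℕ :=
  (Finset.range J).sup fun k =>
    (Finset.range m).sup fun t =>
      Nat.card {s : ℕ | s < m ∧
        b (((k + s * J : ℕ) : ZMod d)) = b (((k + t * J : ℕ) : ZMod d))}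

/-- A matrix `M : Matrix ι κ ℂ` (with `#ι ≤ #κ`) is full spark when every choice of `#ι`
columns is linearly independent, i.e. every maximal square submatrix is invertible. -/
def FullSpark {ι κ : Type*} [Fintype ι] [Fintype κ] (M : Matrix ι κ ℂ) : Prop :=
  ∀ S : Finset κ, S.card = Fintype.card ι →
    LinearIndependent ℂ (fun k : S => fun i : ι => M i (k : κ))


noncomputable def chE (d : ℕ) [NeZero d] (x : ZMod d) : ℂ := ZMod.stdAddChar (-x)

lemma chE_add (d : ℕ) [NeZero d] (x y : ZMod d) : chE d (x + y) = chE d x * chE d y := by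
  unfold chE; rw [neg_add, AddChar.map_add_eq_mul]

lemma chE_ne (d : ℕ) [NeZero d] (x : ZMod d) : chE d x ≠ 0 := by
  intro h
  have := chE_add d x (-x)
  rw [h, add_neg_cancel] at this
  simp [chE] at this

lemma chE_nat (d : ℕ) [NeZero d] (n : ℕ) :
    chE d (n : ZMod d) = Complex.exp (-(2 * (Real.pi : ℂ) * Complex.I) * (n : ℂ) / (d : ℂ)) := by
  have := ZMod.stdAddChar_coe (N := d) (-(n : ℤ))
  unfold chE
  push_cast at this
  rw [this]; congr 1; ring

lemma chE_exp (d : ℕ) [NeZero d] (j k : ZMod d) :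
    Complex.exp (-(2 * (Real.pi : ℂ) * Complex.I) * ((j.val : ℂ) * (k.val : ℂ)) / (d : ℂ))
      = chE d (j * k) := by
  have := chE_nat d (j.val * k.val)
  push_cast at this
  rw [← this]; simp

lemma chE_scale (d m J : ℕ) [NeZero d] [NeZero m] (hd : d = m * J) (n : ℕ) :
    chE d ((J * n : ℕ) : ZMod d) = chE m (n : ZMod m) := by
  have hdn : d ≠ 0 := NeZero.ne d
  have hm : (m : ℂ) ≠ 0 := by exact_mod_cast NeZero.ne m
  have hJ : (J : ℂ) ≠ 0 := by
    have : J ≠ 0 := by rintro rfl; simp at hd; exact hdn hd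
    exact_mod_cast this
  rw [chE_nat, chE_nat]
  congr 1
  rw [show (d : ℂ) = m * J by exact_mod_cast hd]
  push_cast
  field_simp

lemma hatKer_eq (d : ℕ) [NeZero d] (a : ZMod d → ℂ) : hatKer d a = ZMod.dft a := by
  funext j
  rw [ZMod.dft_apply]
  unfold hatKer
  refine Finset.sum_congr rfl fun k _ => ?_
  rw [chE_exp, chE, smul_eq_mul, mul_comm, mul_comm k]

lemma hatKer_conv (d : ℕ) [NeZero d] (a v : ZMod d → ℂ) (j : ZMod d) :
    hatKer d (convMat d a *ᵥ v) j = hatKer d a j * hatKer d v j := by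
  simp only [hatKer, chE_exp, Matrix.mulVec, dotProduct, convMat, Matrix.of_apply]
  rw [Finset.sum_mul_sum]
  simp only [Finset.sum_mul]
  rw [Finset.sum_comm]
  conv_rhs => rw [Finset.sum_comm]
  refine Finset.sum_congr rfl fun i _ => ?_
  rw [← Equiv.sum_comp (Equiv.addRight i)]
  refine Finset.sum_congr rfl fun k _ => ?_
  simp only [Equiv.coe_addRight, add_sub_cancel_right, mul_add, chE_add]
  ring

lemma hatKer_pow (d : ℕ) [NeZero d] (a : ZMod d → ℂ) (i j : ZMod d) (n : ℕ) :
    hatKer d ((convMat d a) ^ n *ᵥ (Pi.single i 1 : ZMod d → ℂ)) j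
      = hatKer d a j ^ n * chE d (j * i) := by
  induction n with
  | zero =>
    simp only [pow_zero, Matrix.one_mulVec, hatKer, chE_exp]
    simp [Pi.single_apply]
  | succ n ih =>
    rw [pow_succ', ← Matrix.mulVec_mulVec, hatKer_conv, ih]; ring

lemma span_iff (d m : ℕ) [NeZero d] (P : ZMod d → Prop) (a : ZMod d → ℂ) :
    Submodule.span ℂ {v : ZMod d → ℂ | ∃ i : ZMod d, P i ∧
        ∃ n ≤ m - 1, v = (convMat d a) ^ n *ᵥ (Pi.single i 1 : ZMod d → ℂ)} = ⊤ ↔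
    ∀ g : ZMod d → ℂ, (∀ i, P i → ∀ n ≤ m - 1,
      ∑ j, g j * (hatKer d a j ^ n * chE d (j * i)) = 0) → g = 0 := by
  constructor
  · intro h g hg
    let φ : (ZMod d → ℂ) →ₗ[ℂ] ℂ := (Fintype.linearCombination ℂ g).comp
      (ZMod.dft (N := d) (E := ℂ)).toLinearMap
    have hφ : ∀ v, φ v = ∑ j, g j * hatKer d v j := by
      intro v
      simp [φ, Fintype.linearCombination_apply, hatKer_eq, mul_comm]
    have h0 : ∀ v, φ v = 0 := by
      intro v
      have hv : v ∈ (⊤ : Submodule ℂ (ZMod d → ℂ)) := trivial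
      rw [← h] at hv
      have hle : Submodule.span ℂ {v : ZMod d → ℂ | ∃ i : ZMod d, P i ∧
        ∃ n ≤ m - 1, v = (convMat d a) ^ n *ᵥ (Pi.single i 1 : ZMod d → ℂ)} ≤
          LinearMap.ker φ := by
        rw [Submodule.span_le]
        rintro w ⟨i, hi, n, hn, rfl⟩
        simp only [SetLike.mem_coe, LinearMap.mem_ker, hφ, hatKer_pow]
        exact hg i hi n hn
      exact hle hv
    funext j
    have := h0 ((ZMod.dft (N := d) (E := ℂ)).symm (Pi.single j 1))
    rw [hφ, hatKer_eq, LinearEquiv.apply_symm_apply] at this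
    simpa [Pi.single_apply] using this
  · intro h
    by_contra hne
    obtain ⟨f, hf0, hf⟩ := Submodule.exists_le_ker_of_lt_top _ (lt_top_iff_ne_top.2 hne)
    apply hf0
    let D := (ZMod.dft (N := d) (E := ℂ))
    have hfv : ∀ v, f v = ∑ j, f (D.symm (Pi.single j 1)) * hatKer d v j := by
      intro v
      have h1 : v = D.symm (∑ j, hatKer d v j • (Pi.single j 1 : ZMod d → ℂ)) := by
        rw [LinearEquiv.eq_symm_apply, ← pi_eq_sum_univ', hatKer_eq]
      conv_lhs => rw [h1]
      simp [map_sum, mul_comm]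
    have hg := h (fun j => f (D.symm (Pi.single j 1))) (by
      intro i hi n hn
      have := hf (Submodule.subset_span ⟨i, hi, n, hn, rfl⟩)
      rw [LinearMap.mem_ker, hfv] at this
      simpa only [hatKer_pow] using this)
    ext v
    have := hfv (Pi.single v 1)
    simp only [LinearMap.comp_apply, LinearMap.coe_single]
    rw [this]
    simp only [fun j => congrFun hg j]
    simp

lemma sum_split (d m J : ℕ) [NeZero d] [NeZero m] (hd : d = m * J) (F : ZMod d → ℂ) :
    ∑ j, F j = ∑ k : Fin J, ∑ s : ZMod m, F ((k.1 + s.val * J : ℕ) : ZMod d) := by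
  have hdn : d ≠ 0 := NeZero.ne d
  have hJ : 0 < J := by
    rcases Nat.eq_zero_or_pos J with rfl | h
    · simp at hd; exact absurd hd hdn
    · exact h
  have hlt : ∀ (k : Fin J) (s : ZMod m), k.1 + s.val * J < d := by
    intro k s
    have := s.val_lt
    have := k.2
    rw [hd]; nlinarith
  rw [← Fintype.sum_prod_type']
  symm
  refine Fintype.sum_bijective (fun p : Fin J × ZMod m => ((p.1.1 + p.2.val * J : ℕ) : ZMod d))
    ⟨?_, ?_⟩ _ _ (fun _ => rfl)
  · rintro ⟨k, s⟩ ⟨k', s'⟩ h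
    have h := congrArg ZMod.val h
    simp only [ZMod.val_natCast_of_lt (hlt _ _)] at h
    have hk : k.1 = k'.1 := by
      have := congrArg (· % J) h
      simpa [Nat.add_mul_mod_self_right, Nat.mod_eq_of_lt k.2, Nat.mod_eq_of_lt k'.2] using this
    have hs : s.val = s'.val := by
      rw [hk] at h
      exact Nat.eq_of_mul_eq_mul_right hJ (Nat.add_left_cancel h)
    exact Prod.ext (Fin.ext hk) (ZMod.val_injective m hs)
  · intro x
    have hx : x.val / J < m := by
      rw [Nat.div_lt_iff_lt_mul hJ, ← hd]; exact x.val_lt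
    refine ⟨(⟨x.val % J, Nat.mod_lt _ hJ⟩, ((x.val / J : ℕ) : ZMod m)), ?_⟩
    simp only [ZMod.val_natCast_of_lt hx]
    rw [mul_comm, Nat.mod_add_div]; simp

lemma chE_mul_nat (d : ℕ) [NeZero d] (x : ZMod d) (l : ℕ) : chE d (x * l) = chE d x ^ l := by
  induction l with
  | zero => simp [chE]
  | succ l ih => rw [Nat.cast_succ, mul_add, mul_one, chE_add, ih, pow_succ]

lemma chE_split (d m J : ℕ) [NeZero d] [NeZero m] (hd : d = m * J) (k l : ℕ) (s r : ZMod m) :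
    chE d (((k + s.val * J : ℕ) : ZMod d) * ((r.val + m * l : ℕ) : ZMod d))
      = chE d ((k * r.val : ℕ) : ZMod d) * chE m (s * r) * chE d ((m * k : ℕ) : ZMod d) ^ l := by
  have h1 : (((k + s.val * J : ℕ) : ZMod d) * ((r.val + m * l : ℕ) : ZMod d))
      = ((k * r.val : ℕ) : ZMod d) + ((J * (s.val * r.val) : ℕ) : ZMod d)
        + ((m * k : ℕ) : ZMod d) * (l : ZMod d) + ((d * (s.val * l) : ℕ) : ZMod d) := by
    rw [show d * (s.val * l) = m * J * (s.val * l) by rw [← hd]]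
    push_cast; ring
  rw [h1, show ((d * (s.val * l) : ℕ) : ZMod d) = 0 by simp, add_zero, chE_add, chE_add,
    chE_scale d m J hd, chE_mul_nat]
  simp

lemma blocks_zero (d m J : ℕ) [NeZero d] [NeZero m] (hd : d = m * J) (G : ZMod d → ℂ)
    (r : ZMod m)
    (h : ∀ i : ZMod d, (i.val : ZMod m) = r → ∑ j, G j * chE d (j * i) = 0) (k : Fin J) :
    ∑ s : ZMod m, G ((k.1 + s.val * J : ℕ) : ZMod d) * chE m (s * r) = 0 := by
  have hmpos : 0 < m := Nat.pos_of_ne_zero (NeZero.ne m)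
  have hlt : ∀ k : Fin J, m * k.1 < d := fun k => by
    rw [hd]; exact Nat.mul_lt_mul_of_pos_left k.2 hmpos
  have key := Matrix.eq_zero_of_forall_pow_sum_mul_pow_eq_zero
    (f := fun k : Fin J => chE d ((m * k.1 : ℕ) : ZMod d))
    (v := fun k : Fin J => chE d ((k.1 * r.val : ℕ) : ZMod d) *
      ∑ s : ZMod m, G ((k.1 + s.val * J : ℕ) : ZMod d) * chE m (s * r))
    (by
      intro k k' hkk
      have h1 := neg_injective (ZMod.injective_stdAddChar hkk)
      have h2 := congrArg ZMod.val h1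
      rw [ZMod.val_natCast_of_lt (hlt k), ZMod.val_natCast_of_lt (hlt k')] at h2
      exact Fin.ext (Nat.eq_of_mul_eq_mul_left hmpos h2))
    (by
      intro l
      have := h ((r.val + m * l.1 : ℕ) : ZMod d) (by
        have : (((((r.val + m * l.1 : ℕ) : ZMod d)).val : ℕ) : ZMod m)
            = ((r.val + m * l.1 : ℕ) : ZMod m) := by
          rw [ZMod.val_natCast, ZMod.natCast_eq_natCast_iff', Nat.mod_mod_of_dvd _ ⟨J, hd⟩]
        rw [this]; simp)
      rw [sum_split d m J hd] at this
      rw [← this]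
      refine Finset.sum_congr rfl fun k _ => ?_
      rw [Finset.mul_sum, Finset.sum_mul]
      refine Finset.sum_congr rfl fun s _ => ?_
      rw [chE_split d m J hd]
      ring)
  have := congrFun key k
  exact (mul_eq_zero.1 this).resolve_left (chE_ne _ _)

lemma fullSpark_iff (m : ℕ) [NeZero m] (W : Finset (ZMod m)) :
    FullSpark (Matrix.of fun (r : ↥W) (k : ZMod m) => FdMat m r.1 k) ↔
    ∀ S : Finset (ZMod m), S.card = W.card → ∀ c : ZMod m → ℂ,
      (∀ r ∈ W, ∑ s ∈ S, c s * chE m (s * r) = 0) → ∀ s ∈ S, c s = 0 := by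
  have hsq : ((Real.sqrt m : ℝ) : ℂ)⁻¹ ≠ 0 := by
    apply inv_ne_zero
    have : (0:ℝ) < m := by exact_mod_cast Nat.pos_of_ne_zero (NeZero.ne m)
    exact_mod_cast (Real.sqrt_pos.2 this).ne'
  unfold FullSpark
  simp only [Fintype.card_coe]
  refine forall_congr' fun S => forall_congr' fun _ => ?_
  rw [Fintype.linearIndependent_iff]
  have hval : ∀ (c : ZMod m → ℂ),
      (∑ k : S, c k.1 • (fun i : W => (Matrix.of fun (r : ↥W) (k : ZMod m) => FdMat m r.1 k) i k.1))
        = 0 ↔ (∀ r ∈ W, ∑ s ∈ S, c s * chE m (s * r) = 0) := by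
    intro c
    rw [funext_iff]
    simp only [Finset.sum_apply, Pi.smul_apply, Matrix.of_apply, FdMat, chE_exp, smul_eq_mul,
      Pi.zero_apply, Subtype.forall]
    refine forall_congr' fun r => forall_congr' fun _ => ?_
    have : ∑ k : S, c k.1 * (((Real.sqrt m : ℝ) : ℂ)⁻¹ * chE m (r * k.1))
        = ((Real.sqrt m : ℝ) : ℂ)⁻¹ * ∑ s ∈ S, c s * chE m (s * r) := by
      rw [Finset.mul_sum, ← Finset.sum_coe_sort S]
      refine Finset.sum_congr rfl fun s _ => ?_
      rw [mul_comm r]; ring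
    rw [this]
    simp [hsq]
  constructor
  · intro h c hc s hs
    exact h (fun k => c k.1) ((hval c).2 hc) ⟨s, hs⟩
  · intro h g hg i
    have h1 : ∀ k : S, (if hk : k.1 ∈ S then g ⟨k.1, hk⟩ else 0) = g k := fun k => by simp
    have := h (fun s => if hs : s ∈ S then g ⟨s, hs⟩ else 0) ((hval _).1 (by
      simp only [h1]; exact hg)) i.1 i.2
    simpa using this

lemma block_core (m : ℕ) [NeZero m] (W : Finset (ZMod m)) (hWm : W.card < m)
    (hFS : ∀ S : Finset (ZMod m), S.card = W.card → ∀ c : ZMod m → ℂ,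
      (∀ r ∈ W, ∑ s ∈ S, c s * chE m (s * r) = 0) → ∀ s ∈ S, c s = 0)
    (β c : ZMod m → ℂ)
    (hβ : ∀ t, (Finset.univ.filter fun s => β s = β t).card ≤ W.card)
    (h : ∀ r ∈ W, ∀ n ≤ m - 1, ∑ s, c s * β s ^ n * chE m (s * r) = 0) : ∀ t, c t = 0 := by
  intro t
  have hmpos : 0 < m := Nat.pos_of_ne_zero (NeZero.ne m)
  let T : Finset ℂ := (Finset.univ.image β).erase (β t)
  let p : Polynomial ℂ := ∏ μ ∈ T, (Polynomial.X - Polynomial.C μ)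
  have hp : p.natDegree < m := by
    have h1 : p.natDegree = T.card := by
      exact Polynomial.natDegree_finsetProd_X_sub_C_eq_card T (fun x : ℂ => x)
    have h2 : (Finset.univ.image β).card ≤ m := by
      simpa [ZMod.card] using (Finset.card_image_le (s := Finset.univ) (f := β))
    have h3 : T.card = (Finset.univ.image β).card - 1 :=
      Finset.card_erase_of_mem (Finset.mem_image_of_mem _ (Finset.mem_univ t))
    omega
  have hpt : p.eval (β t) ≠ 0 := by
    simp only [p, Polynomial.eval_prod]
    rw [Finset.prod_ne_zero_iff]
    intro μ hμ
    have := Finset.ne_of_mem_erase hμ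
    simp [sub_ne_zero, this.symm]
  have hps : ∀ s, β s ≠ β t → p.eval (β s) = 0 := by
    intro s hs
    simp only [p, Polynomial.eval_prod]
    refine Finset.prod_eq_zero (i := β s) ?_ (by simp)
    exact Finset.mem_erase.2 ⟨hs, Finset.mem_image_of_mem _ (Finset.mem_univ s)⟩
  obtain ⟨S, hTS, -, hS⟩ := Finset.exists_subsuperset_card_eq
    (Finset.subset_univ (Finset.univ.filter fun s => β s = β t)) (hβ t)
    (by rw [Finset.card_univ, ZMod.card]; exact hWm.le)
  have := hFS S hS (fun s => if β s = β t then c s else 0) (by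
    intro r hr
    have h1 : ∑ s, c s * p.eval (β s) * chE m (s * r) = 0 := by
      simp only [Polynomial.eval_eq_sum_range' hp, Finset.mul_sum, Finset.sum_mul]
      rw [Finset.sum_comm]
      refine Finset.sum_eq_zero fun n hn => ?_
      have := h r hr n (by have := Finset.mem_range.1 hn; omega)
      rw [← mul_zero (p.coeff n), ← this, Finset.mul_sum]
      refine Finset.sum_congr rfl fun s _ => ?_
      ring
    have h2 : p.eval (β t) * ∑ s ∈ S, (if β s = β t then c s else 0) * chE m (s * r) = 0 := by
      refine Eq.trans ?_ h1
      rw [Finset.mul_sum]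
      rw [← Finset.sum_subset (Finset.subset_univ S)]
      · refine Finset.sum_congr rfl fun s _ => ?_
        by_cases hs : β s = β t
        · simp [hs]; ring
        · simp [hs, hps s hs]
      · intro s _ hs
        have : β s ≠ β t := fun hh => hs (hTS (by simp [hh]))
        simp [hps s this]
    exact (mul_eq_zero.1 h2).resolve_left hpt) t (hTS (by simp))
  simpa using this

lemma card_conv (m : ℕ) [NeZero m] (Q : ℕ → Prop) [DecidablePred Q] :
    Nat.card {s : ℕ | s < m ∧ Q s} = (Finset.univ.filter fun s : ZMod m => Q s.val).card := by
  rw [Nat.card_coe_set_eq, ← Finset.card_image_of_injective _ (ZMod.val_injective m),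
    ← Set.ncard_coe_finset]
  congr 1
  ext s
  simp only [Set.mem_ofPred_eq, Finset.coe_image, Finset.coe_filter, Finset.mem_univ, true_and,
    Set.mem_image]
  constructor
  · rintro ⟨hs, hq⟩
    exact ⟨(s : ZMod m), by rwa [ZMod.val_natCast_of_lt hs], ZMod.val_natCast_of_lt hs⟩
  · rintro ⟨x, hx, rfl⟩
    exact ⟨x.val_lt, hx⟩

/-- with `d = mJ`, `m > 1`, `W ⊂ ℤ_m`, `|W| = L < m` and
`Ω = ∪_{r ∈ W} (mℤ_d + r)`, the family `Y = {A^n e_i : i ∈ Ω, n ≤ m - 1}` is a frame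
for every `A ∈ ℬ_L` iff the row submatrix `(F_m)_W` of `F_m` is full spark. -/
theorem stmt10 (d m J L : ℕ) [NeZero d] [NeZero m] (hm : 1 < m) (hd : d = m * J)
    (W : Finset (ZMod m)) (hW : W.card = L) (hL : L < m) :
    (∀ a : ZMod d → ℂ, maxMultB d m J (hatKer d a) = L →
      Submodule.span ℂ {v : ZMod d → ℂ | ∃ i : ZMod d, ((i.val : ZMod m) ∈ W) ∧
        ∃ n ≤ m - 1, v = (convMat d a) ^ n *ᵥ (Pi.single i 1 : ZMod d → ℂ)} = ⊤)
    ↔ FullSpark (Matrix.of fun (r : ↥W) (k : ZMod m) => FdMat m r.1 k) := by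

  classical
  rw [fullSpark_iff]
  simp only [span_iff d m]
  have hdn : d ≠ 0 := NeZero.ne d
  have hJ : 0 < J := by
    rcases Nat.eq_zero_or_pos J with rfl | h
    · simp at hd; exact absurd hd hdn
    · exact h
  have hlt : ∀ k < J, ∀ (s : ZMod m), k + s.val * J < d := by
    intro k hk s
    have := s.val_lt
    rw [hd]; nlinarith
  constructor
  · intro h S hS c hc
    by_contra! hne
    obtain ⟨s0, hs0, hcs0⟩ := hne
    let R : ZMod d → Prop := fun j => ∃ s ∈ S, j = ((0 + s.val * J : ℕ) : ZMod d)
    have hR : ∀ k < J, ∀ s : ZMod m, R ((k + s.val * J : ℕ) : ZMod d) → k = 0 ∧ s ∈ S := by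
      rintro k hk s ⟨s', hs', he⟩
      have he := congrArg ZMod.val he
      rw [ZMod.val_natCast_of_lt (hlt k hk s), ZMod.val_natCast_of_lt (hlt 0 hJ s')] at he
      have hk0 : k = 0 := by
        have := congrArg (· % J) he
        simpa [Nat.add_mul_mod_self_right, Nat.mod_eq_of_lt hk] using this
      subst hk0
      refine ⟨rfl, ?_⟩
      have : s.val = s'.val := Nat.eq_of_mul_eq_mul_right hJ (Nat.add_left_cancel he)
      rwa [ZMod.val_injective m this]
    let b : ZMod d → ℂ := fun j => if R j then 0 else ((j.val + 1 : ℕ) : ℂ)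
    have hb0 : ∀ j, b j = 0 ↔ R j := by
      intro j
      by_cases hj : R j
      · simp [b, hj]
      · simp only [b, hj, if_false, iff_false]
        exact Nat.cast_ne_zero.2 (Nat.succ_ne_zero _)
    have hbi : ∀ j j', ¬ R j → b j' = b j → j' = j := by
      intro j j' hj he
      have hj' : ¬ R j' := by rw [← hb0, he, hb0]; exact hj
      simp only [b, hj, hj', if_false] at he
      have : j'.val + 1 = j.val + 1 := by exact_mod_cast he
      exact ZMod.val_injective d (by omega)
    have hL1 : 1 ≤ L := by
      rw [← hW, ← hS]; exact Finset.card_pos.2 ⟨s0, hs0⟩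
    have hab : hatKer d ((ZMod.dft (N := d) (E := ℂ)).symm b) = b := by
      rw [hatKer_eq, LinearEquiv.apply_symm_apply]
    have hmax : maxMultB d m J b = L := by
      unfold maxMultB
      apply le_antisymm
      · refine Finset.sup_le fun k hk => Finset.sup_le fun t ht => ?_
        rw [card_conv m fun s => b ((k + s * J : ℕ) : ZMod d) = b ((k + t * J : ℕ) : ZMod d)]
        have hk := Finset.mem_range.1 hk
        have ht := Finset.mem_range.1 ht
        by_cases hz : R ((k + t * J : ℕ) : ZMod d)
        · rw [← hW, ← hS]
          refine Finset.card_le_card fun s hs => ?_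
          have hs := (Finset.mem_filter.1 hs).2
          rw [(hb0 _).2 hz, hb0] at hs
          exact (hR k hk s hs).2
        · refine le_trans (Finset.card_le_one.2 ?_) hL1
          have : ∀ s : ZMod m, b ((k + s.val * J : ℕ) : ZMod d) = b ((k + t * J : ℕ) : ZMod d) →
              s.val = t := by
            intro s hs
            have he := congrArg ZMod.val (hbi _ _ hz hs)
            have h2 := hlt k hk (t : ZMod m)
            rw [ZMod.val_natCast_of_lt ht] at h2
            rw [ZMod.val_natCast_of_lt (hlt k hk s), ZMod.val_natCast_of_lt h2] at he
            exact Nat.eq_of_mul_eq_mul_right hJ (Nat.add_left_cancel he)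
          intro x hx y hy
          apply ZMod.val_injective m
          rw [this x (Finset.mem_filter.1 hx).2, this y (Finset.mem_filter.1 hy).2]
      · refine le_trans ?_ (Finset.le_sup (Finset.mem_range.2 hJ))
        refine le_trans ?_ (Finset.le_sup (Finset.mem_range.2 s0.val_lt))
        rw [card_conv m fun s => b ((0 + s * J : ℕ) : ZMod d) = b ((0 + s0.val * J : ℕ) : ZMod d)]
        rw [← hW, ← hS]
        refine Finset.card_le_card fun s hs => ?_
        refine Finset.mem_filter.2 ⟨Finset.mem_univ _, ?_⟩
        rw [(hb0 _).2 ⟨s, hs, rfl⟩, (hb0 _).2 ⟨s0, hs0, rfl⟩]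
    let g : ZMod d → ℂ := fun j => if R j then c ((j.val / J : ℕ) : ZMod m) else 0
    have hgv : ∀ s ∈ S, g ((0 + s.val * J : ℕ) : ZMod d) = c s := by
      intro s hs
      have : R ((0 + s.val * J : ℕ) : ZMod d) := ⟨s, hs, rfl⟩
      simp only [g, this, if_true]
      rw [ZMod.val_natCast_of_lt (hlt 0 hJ s), zero_add, Nat.mul_div_cancel _ hJ]
      simp
    have hg := h ((ZMod.dft (N := d) (E := ℂ)).symm b) (by rw [hab, hmax]) g (by
      intro i hi n hn
      rw [hab]
      have hi' : i = (((i.val : ZMod m).val + m * (i.val / m) : ℕ) : ZMod d) := by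
        rw [ZMod.val_natCast, Nat.mod_add_div]; simp
      rw [sum_split d m J hd, Finset.sum_eq_single (⟨0, hJ⟩ : Fin J)]
      · rw [← Finset.sum_subset (Finset.subset_univ S)]
        · have h0 := hc _ hi
          refine Eq.trans ?_ ((congrArg (fun z : ℂ => (0 : ℂ) ^ n * z) h0).trans (mul_zero _))
          simp only [Finset.mul_sum]
          refine Finset.sum_congr rfl fun s hs => ?_
          rw [hgv s hs, (hb0 _).2 ⟨s, hs, rfl⟩]
          conv_lhs => rw [hi']
          rw [chE_split d m J hd]
          simp [chE]
          ring
        · intro s _ hs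
          have : ¬ R ((0 + s.val * J : ℕ) : ZMod d) := fun hh => hs (hR 0 hJ s hh).2
          simp only [g, this, if_false, zero_mul]
      · intro k _ hk
        refine Finset.sum_eq_zero fun s _ => ?_
        have : ¬ R ((k.1 + s.val * J : ℕ) : ZMod d) :=
          fun hh => hk (Fin.ext (hR k.1 k.2 s hh).1)
        simp only [g, this, if_false, zero_mul]
      · simp)
    apply hcs0
    rw [← hgv s0 hs0, hg]; rfl
  · intro hFS a ha g hg
    have key : ∀ k : Fin J, ∀ t : ZMod m, g ((k.1 + t.val * J : ℕ) : ZMod d) = 0 := by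
      intro k
      refine block_core m W (by omega) hFS
        (fun s => hatKer d a ((k.1 + s.val * J : ℕ) : ZMod d))
        (fun s => g ((k.1 + s.val * J : ℕ) : ZMod d)) ?_ ?_
      · intro t
        rw [hW, ← ha]
        unfold maxMultB
        refine le_trans ?_ (Finset.le_sup (Finset.mem_range.2 k.2))
        refine le_trans ?_ (Finset.le_sup (Finset.mem_range.2 t.val_lt))
        rw [card_conv m fun s => hatKer d a ((k.1 + s * J : ℕ) : ZMod d)
          = hatKer d a ((k.1 + t.val * J : ℕ) : ZMod d)]
      · intro r hr n hn
        refine blocks_zero d m J hd (fun j => g j * hatKer d a j ^ n) r ?_ k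
        intro i hi
        have := hg i (hi ▸ hr) n hn
        rw [← this]
        exact Finset.sum_congr rfl fun j _ => by ring
    funext j
    have hx : j.val / J < m := by
      rw [Nat.div_lt_iff_lt_mul hJ, ← hd]; exact j.val_lt
    have := key ⟨j.val % J, Nat.mod_lt _ hJ⟩ ((j.val / J : ℕ) : ZMod m)
    simp only [ZMod.val_natCast_of_lt hx] at this
    rw [mul_comm, Nat.mod_add_div] at this
    simpa using this
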